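/- arXiv:1110.6489 — 6 statements merged into one kernel-verified Lean document; each statement's English description precedes it below -/
import Mathlib

section
/- Let r, s, c, d be integers with 0 < r ≤ N/2, 0 < s ≤ N/2, r ≠ s and gcd(c,d) = 1. Assume {rc} = {sc}. Then ζ^{μ(rc)·r·d − μ(sc)·s·d} ≠ 1, i.e., μ(rc)·r·d ≢ μ(sc)·s·d (mod N). -/
/-- For an integer `x`, `Ibr N x` is the unique integer `{x}` with `0 ≤ {x} ≤ N/2` such that
`x ≡ {x} (mod N)` or `x ≡ -{x} (mod N)`. -/
def Ibr (N : ℕ) (x : ℤ) : ℤ := min (x % (N : ℤ)) ((N : ℤ) - x % (N : ℤ))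

/-- `Imu N x = μ(x) ∈ {1, -1}`: it is `1` if `x ≡ 0` or `N/2 (mod N)`, and otherwise it is the
sign such that `x ≡ μ(x)·{x} (mod N)`. -/
def Imu (N : ℕ) (x : ℤ) : ℤ := if 2 * (x % (N : ℤ)) ≤ (N : ℤ) then 1 else -1

lemma Imu_mul_sub_Ibr (N : ℕ) (x : ℤ) : (N : ℤ) ∣ Imu N x * x - Ibr N x := by
  have hx := Int.emod_add_mul_ediv x N
  unfold Imu Ibr
  split_ifs with h
  · rw [min_eq_left (by linarith)]
    exact ⟨x / N, by linarith⟩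
  · rw [min_eq_right (by linarith)]
    exact ⟨-(x / N) - 1, by linarith⟩

lemma Imu_cases (N : ℕ) (x : ℤ) : Imu N x = 1 ∨ Imu N x = -1 := by
  unfold Imu
  split_ifs <;> simp

/-- Lemma 1, first part: if `0 < r, s ≤ N/2`, `r ≠ s`, `gcd(c,d) = 1` and `{rc} = {sc}`, then
`ζ^{μ(rc)rd − μ(sc)sd} ≠ 1`, i.e. `μ(rc)·r·d ≢ μ(sc)·s·d (mod N)`. -/
theorem statement0 (N : ℕ) (hN : 6 < N) {K : Type*} [Field K] (ζ : K)
    (hζ : IsPrimitiveRoot ζ N) (r s c d : ℤ)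
    (hr0 : 0 < r) (hr2 : 2 * r ≤ (N : ℤ)) (hs0 : 0 < s) (hs2 : 2 * s ≤ (N : ℤ))
    (hrs : r ≠ s) (hcd : Int.gcd c d = 1)
    (h : Ibr N (r * c) = Ibr N (s * c)) :
    ζ ^ (Imu N (r * c) * r * d - Imu N (s * c) * s * d) ≠ 1 ∧
      ¬ ((N : ℤ) ∣ (Imu N (r * c) * r * d - Imu N (s * c) * s * d)) := by
  have key : ¬ ((N : ℤ) ∣ (Imu N (r * c) * r * d - Imu N (s * c) * s * d)) := by
    intro hd
    have h1 := Imu_mul_sub_Ibr N (r * c)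
    have h2 := Imu_mul_sub_Ibr N (s * c)
    have hc : (N : ℤ) ∣ (Imu N (r * c) * r - Imu N (s * c) * s) * c := by
      have h3 := dvd_sub h1 h2
      rw [h] at h3
      have e3 : (Imu N (r * c) * r - Imu N (s * c) * s) * c
          = Imu N (r * c) * (r * c) - Ibr N (s * c) - (Imu N (s * c) * (s * c) - Ibr N (s * c)) := by
        ring
      rw [e3]
      exact h3
    have hd' : (N : ℤ) ∣ (Imu N (r * c) * r - Imu N (s * c) * s) * d := by
      rw [sub_mul]
      exact hd
    have hm : (N : ℤ) ∣ Imu N (r * c) * r - Imu N (s * c) * s := by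
      obtain ⟨u, v, huv⟩ := Int.isCoprime_iff_gcd_eq_one.mpr hcd
      have h4 := dvd_add (hc.mul_left u) (hd'.mul_left v)
      have e4 : Imu N (r * c) * r - Imu N (s * c) * s
          = u * ((Imu N (r * c) * r - Imu N (s * c) * s) * c)
            + v * ((Imu N (r * c) * r - Imu N (s * c) * s) * d) := by
        linear_combination (-(Imu N (r * c) * r - Imu N (s * c) * s)) * huv
      rw [e4]
      exact h4
    have hlt : |Imu N (r * c) * r - Imu N (s * c) * s| < (N : ℤ) := by
      rw [abs_lt]
      rcases Imu_cases N (r * c) with e | e <;> rcases Imu_cases N (s * c) with f | f <;>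
        rw [e, f] <;> constructor <;> omega
    have h0 := Int.eq_zero_of_abs_lt_dvd hm hlt
    rcases Imu_cases N (r * c) with e | e <;> rcases Imu_cases N (s * c) with f | f <;>
      rw [e, f] at h0 <;> omega
  exact ⟨fun h1 => key ((hζ.zpow_eq_one_iff_dvd _).mp h1), key⟩
end

section
/- Let r, s, c, d be integers with 0 < r ≤ N/2, 0 < s ≤ N/2, r ≠ s and gcd(c,d) = 1. Assume {rc} = {sc} and moreover {rc} = 0 or {rc} = N/2. Then ζ^{μ(rc)·r·d + μ(sc)·s·d} ≠ 1, i.e., μ(rc)·r·d + μ(sc)·s·d ≢ 0 (mod N). -/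
/-- Lemma 1, second part: if moreover `{rc} = {sc} = 0` or `N/2`, then
`ζ^{μ(rc)rd + μ(sc)sd} ≠ 1`, i.e. `μ(rc)·r·d + μ(sc)·s·d ≢ 0 (mod N)`. -/
theorem statement1 (N : ℕ) (hN : 6 < N) {K : Type*} [Field K] (ζ : K)
    (hζ : IsPrimitiveRoot ζ N) (r s c d : ℤ)
    (hr0 : 0 < r) (hr2 : 2 * r ≤ (N : ℤ)) (hs0 : 0 < s) (hs2 : 2 * s ≤ (N : ℤ))
    (hrs : r ≠ s) (hcd : Int.gcd c d = 1)
    (h : Ibr N (r * c) = Ibr N (s * c))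
    (h0 : Ibr N (r * c) = 0 ∨ 2 * Ibr N (r * c) = (N : ℤ)) :
    ζ ^ (Imu N (r * c) * r * d + Imu N (s * c) * s * d) ≠ 1 ∧
      ¬ ((N : ℤ) ∣ (Imu N (r * c) * r * d + Imu N (s * c) * s * d)) := by
  have key : ¬ ((N : ℤ) ∣ (Imu N (r * c) * r * d + Imu N (s * c) * s * d)) := by
    intro hd
    have hNpos : (0 : ℤ) < N := by omega
    have a1 := Int.emod_nonneg (r * c) hNpos.ne'
    have a2 := Int.emod_lt_of_pos (r * c) hNpos
    have b1 := Int.emod_nonneg (s * c) hNpos.ne'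
    have b2 := Int.emod_lt_of_pos (s * c) hNpos
    have e1 := Int.emod_add_mul_ediv (r * c) N
    have e2 := Int.emod_add_mul_ediv (s * c) N
    unfold Ibr at h h0
    have m1 : Imu N (r * c) = 1 := by
      unfold Imu
      rw [if_pos]
      omega
    have m2 : Imu N (s * c) = 1 := by
      unfold Imu
      rw [if_pos]
      omega
    rw [m1, m2] at hd
    have hd' : (N : ℤ) ∣ (r + s) * d := by
      convert hd using 1
      ring
    have hsum : (r * c) % (N : ℤ) + (s * c) % (N : ℤ) = 0 ∨
        (r * c) % (N : ℤ) + (s * c) % (N : ℤ) = N := by omega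
    have hc : (N : ℤ) ∣ (r + s) * c := by
      rcases hsum with h1 | h1
      · exact ⟨r * c / N + s * c / N, by linear_combination h1 - e1 - e2⟩
      · exact ⟨r * c / N + s * c / N + 1, by linear_combination h1 - e1 - e2⟩
    have hbez := Int.gcd_eq_gcd_ab c d
    rw [hcd] at hbez
    have hN' : (N : ℤ) ∣ r + s := by
      have h3 := dvd_add (hc.mul_right (Int.gcdA c d)) (hd'.mul_right (Int.gcdB c d))
      push_cast at hbez
      have h4 : r + s = (r + s) * c * Int.gcdA c d + (r + s) * d * Int.gcdB c d := by
        linear_combination (r + s) * hbez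
      rw [h4]
      exact h3
    have := Int.le_of_dvd (by omega) hN'
    omega
  exact ⟨fun hz => key ((hζ.zpow_eq_one_iff_dvd _).1 hz), key⟩
end

section
/- Let k, ℓ be integers with 1 < ℓ ≤ N/2, 1 < k ≤ N/2, k ≠ ℓ, and assume gcd(k(ℓ−1), N) = 1 and gcd(k(ℓ+1), N) = 1. Then for every A ∈ SL₂(ℤ), the power series Φ_ℓ(A) − Φ_1(A) is nonzero, and the quotient (Φ_k(A) − Φ_1(A)) / (Φ_ℓ(A) − Φ_1(A)), formed in the field of formal Laurent series ℚ(ζ)((q)), has all of its coefficients in ℤ[ζ]. -/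
/-- The formal power series `Φ_s(A)` (the q-expansion of `φ_s[A]₂`, `q = e^{2πiτ/N}`),
for `A = (a b; c d) ∈ SL₂(ℤ)`:  with `s* = μ(sc)·s·d`,
`Φ_s(A) = ζ^{s*}/(1−ζ^{s*})² − Σ_{m≥1} Σ_{n≥1} n(1−ζ^{s*n})(1−ζ^{−s*n}) q^{mnN}` if `{sc} = 0`,
and `Φ_s(A) = Σ_{n≥1} n ζ^{s*n} q^{n{sc}}
  − Σ_{m≥1} Σ_{n≥1} n·(2 q^{mnN} − ζ^{s*n} q^{n(mN+{sc})} − ζ^{−s*n} q^{n(mN−{sc})})` otherwise. -/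
noncomputable def Phi (N : ℕ) {K : Type*} [Field K] (ζ : K) (c d s : ℤ) : PowerSeries K :=
  letI : TopologicalSpace K := ⊥
  let s' : ℤ := Imu N (s * c) * s * d
  let b : ℕ := (Ibr N (s * c)).toNat
  if b = 0 then
    PowerSeries.mk fun j =>
      (if j = 0 then ζ ^ s' / (1 - ζ ^ s') ^ 2 else 0) -
        ∑' (m : ℕ+) (n : ℕ+),
          if j = (m : ℕ) * (n : ℕ) * N then
            ((n : ℕ) : K) * (1 - ζ ^ (s' * (n : ℕ))) * (1 - ζ ^ (-(s' * (n : ℕ))))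
          else 0
  else
    PowerSeries.mk fun j =>
      (∑' (n : ℕ+), if j = (n : ℕ) * b then ((n : ℕ) : K) * ζ ^ (s' * (n : ℕ)) else 0) -
        ∑' (m : ℕ+) (n : ℕ+),
          ((n : ℕ) : K) *
            (2 * (if j = (m : ℕ) * (n : ℕ) * N then (1 : K) else 0) -
              ζ ^ (s' * (n : ℕ)) * (if j = (n : ℕ) * ((m : ℕ) * N + b) then (1 : K) else 0) -
              ζ ^ (-(s' * (n : ℕ))) * (if j = (n : ℕ) * ((m : ℕ) * N - b) then (1 : K) else 0))


open PowerSeries in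
lemma aux_quot {K : Type*} [Field K] (R : Subring K) (e : K) (he : e ≠ 0) (P Q : PowerSeries K)
    (n : ℕ) (hP : ∀ j, e * coeff j P ∈ R) (hQ : ∀ j, e * coeff j Q ∈ R)
    (hQ0 : ∀ j < n, coeff j Q = 0) (hv0 : e * coeff n Q ≠ 0) (hv : (e * coeff n Q)⁻¹ ∈ R) :
    Q ≠ 0 ∧ ∀ i : ℤ, ((P : LaurentSeries K) / (Q : LaurentSeries K)).coeff i ∈ R := by
  have hQne : Q ≠ 0 := by
    rintro rfl
    simp at hv0
  refine ⟨hQne, ?_⟩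
  let F : PowerSeries R := PowerSeries.mk fun j => ⟨_, hP j⟩
  let G : PowerSeries R := PowerSeries.mk fun j => ⟨_, hQ (j + n)⟩
  have hF : PowerSeries.map R.subtype F = C e * P := by
    ext j; simp [F]
  have hG : PowerSeries.X ^ n * PowerSeries.map R.subtype G = C e * Q := by
    ext j
    rw [coeff_X_pow_mul']
    split_ifs with h
    · simp [G, Nat.sub_add_cancel h]
    · simp [hQ0 j (by omega)]
  have hu : IsUnit G := by
    rw [PowerSeries.isUnit_iff_constantCoeff]
    refine IsUnit.of_mul_eq_one ⟨_, hv⟩ ?_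
    apply Subtype.ext
    simp only [G, Subring.coe_mul, Subring.coe_one, ← coeff_zero_eq_constantCoeff_apply, coeff_mk,
      zero_add]
    exact mul_inv_cancel₀ hv0
  obtain ⟨H, hH⟩ := hu.exists_right_inv
  have hGH : PowerSeries.map R.subtype G * PowerSeries.map R.subtype H = 1 := by
    rw [← map_mul, hH, map_one]
  have key : PowerSeries.X ^ n * P = PowerSeries.map R.subtype (F * H) * Q := by
    have hc : (C e : PowerSeries K) ≠ 0 := by simpa using he
    apply mul_left_cancel₀ hc
    calc C e * (PowerSeries.X ^ n * P) = PowerSeries.X ^ n * (C e * P) := by ring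
      _ = (PowerSeries.map R.subtype F) * (PowerSeries.X ^ n) *
          (PowerSeries.map R.subtype G * PowerSeries.map R.subtype H) := by
            rw [hGH, ← hF]; ring
      _ = PowerSeries.map R.subtype F * PowerSeries.map R.subtype H *
          (PowerSeries.X ^ n * PowerSeries.map R.subtype G) := by ring
      _ = _ := by rw [hG, map_mul]; ring
  intro i
  have hQL : (Q : LaurentSeries K) ≠ 0 := by
    intro h
    apply hQne
    exact HahnSeries.ofPowerSeries_injective (Γ := ℤ) (R := K) (by simpa using h)
  have key2 : (P : LaurentSeries K) / (Q : LaurentSeries K) =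
      HahnSeries.single (-(n : ℤ)) (1 : K) *
        ((PowerSeries.map R.subtype (F * H) : PowerSeries K) : LaurentSeries K) := by
    rw [div_eq_iff hQL, mul_assoc]
    have h1 : HahnSeries.ofPowerSeries ℤ K (PowerSeries.X ^ n * P) =
      HahnSeries.ofPowerSeries ℤ K (PowerSeries.map R.subtype (F * H) * Q) := by rw [key]
    rw [map_mul, map_mul, HahnSeries.ofPowerSeries_X_pow] at h1
    change _ = HahnSeries.single (-(n : ℤ)) (1 : K) * (HahnSeries.ofPowerSeries ℤ K _ *
      HahnSeries.ofPowerSeries ℤ K _)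
    rw [← h1, ← mul_assoc, HahnSeries.single_mul_single]
    simp
  rw [key2]
  have h2 := HahnSeries.coeff_single_mul_add (r := (1 : K))
    (x := ((PowerSeries.map R.subtype (F * H) : PowerSeries K) : LaurentSeries K))
    (a := i + n) (b := -(n : ℤ))
  rw [show i + n + -(n : ℤ) = i by ring] at h2
  rw [h2, one_mul, PowerSeries.coeff_coe]
  split_ifs
  · exact R.zero_mem
  · rw [PowerSeries.coeff_map]
    exact (coeff _ (F * H)).2

section roots
variable {K : Type*} [Field K] {ζ : K} {N : ℕ}

lemma aux_zpow (hN : 0 < N) (hζ : IsPrimitiveRoot ζ N) (n : ℤ) :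
    ζ ^ n ∈ Subring.closure {ζ} := by
  have h0 : ζ ≠ 0 := hζ.ne_zero (by omega)
  have : ζ ^ n = ζ ^ (n % N).toNat := by
    rw [← zpow_natCast, Int.toNat_of_nonneg (Int.emod_nonneg _ (by omega))]
    have h1 : ζ ^ n = ζ ^ (n % (N : ℤ) + (N : ℤ) * (n / (N : ℤ))) := by
      rw [Int.emod_add_mul_ediv]
    rw [h1, zpow_add₀ h0, zpow_mul, zpow_natCast, hζ.pow_eq_one, one_zpow, mul_one]
  rw [this]
  exact pow_mem (Subring.subset_closure (Set.mem_singleton ζ)) _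

lemma aux_div (hN : 0 < N) (hζ : IsPrimitiveRoot ζ N) (i j : ℤ) (hj : IsCoprime j (N : ℤ)) :
    (1 - ζ ^ i) / (1 - ζ ^ j) ∈ Subring.closure {ζ} := by
  have h0 : ζ ≠ 0 := hζ.ne_zero (by omega)
  obtain ⟨u, v, huv⟩ := hj
  obtain ⟨t, ht⟩ : ∃ t : ℕ, ζ ^ i = (ζ ^ j) ^ t := by
    refine ⟨((i * u) % N).toNat, ?_⟩
    rw [← zpow_natCast, Int.toNat_of_nonneg (Int.emod_nonneg _ (by omega)), ← zpow_mul]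
    rw [← div_eq_one_iff_eq (zpow_ne_zero _ h0), ← zpow_sub₀ h0, hζ.zpow_eq_one_iff_dvd]
    have h1 := Int.emod_add_mul_ediv (i * u) N
    refine ⟨i * v + j * (i * u / N), ?_⟩
    linear_combination (-i) * huv - j * h1
  rw [ht]
  by_cases h1 : 1 - ζ ^ j = 0
  · rw [h1, div_zero]; exact zero_mem _
  · have : (1 - (ζ ^ j) ^ t) / (1 - ζ ^ j) = ∑ m ∈ Finset.range t, (ζ ^ j) ^ m := by
      rw [div_eq_iff h1, geom_sum_mul_neg]
    rw [this]
    exact sum_mem fun m _ => pow_mem (aux_zpow hN hζ j) m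

lemma aux_tsum {K ι : Type*} [Field K] [TopologicalSpace K] [DiscreteTopology K] (R : Subring K)
    (f : ι → K) (hf : ∀ i, f i ∈ R) : ∑' i, f i ∈ R := by
  by_cases h : Summable f
  · exact (isClosed_discrete (R : Set K)).mem_of_tendsto h.hasSum
      (Filter.Eventually.of_forall fun s => sum_mem fun i _ => hf i)
  · rw [tsum_eq_zero_of_not_summable h]; exact R.zero_mem

open PowerSeries

lemma aux_phi_zero0 (hN : 0 < N) (c d s : ℤ)
    (hb : (Ibr N (s * c)).toNat = 0) :
    coeff 0 (Phi N ζ c d s) = ζ ^ (Imu N (s * c) * s * d) /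
      (1 - ζ ^ (Imu N (s * c) * s * d)) ^ 2 := by
  simp only [Phi, hb, if_true, coeff_mk]
  rw [sub_eq_self]
  letI : TopologicalSpace K := ⊥
  have : ∀ m n : ℕ+, ¬ (0 = (m : ℕ) * (n : ℕ) * N) := fun m n => by
    have := m.pos
    have := n.pos
    positivity
  simp [this]

lemma aux_phi_zero (hN : 0 < N) (hζ : IsPrimitiveRoot ζ N) (c d s : ℤ)
    (hb : (Ibr N (s * c)).toNat = 0) (j : ℕ) (hj : j ≠ 0) :
    coeff j (Phi N ζ c d s) ∈ Subring.closure {ζ} := by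
  simp only [Phi, hb, if_true, coeff_mk, if_neg hj]
  letI : TopologicalSpace K := ⊥
  haveI : DiscreteTopology K := ⟨rfl⟩
  refine sub_mem (zero_mem _) (aux_tsum _ _ fun m => aux_tsum _ _ fun n => ?_)
  split_ifs
  · exact mul_mem (mul_mem (natCast_mem _ _) (sub_mem (one_mem _) (aux_zpow hN hζ _)))
      (sub_mem (one_mem _) (aux_zpow hN hζ _))
  · exact zero_mem _

lemma aux_phi_nz (hN : 0 < N) (hζ : IsPrimitiveRoot ζ N) (c d s : ℤ)
    (hb : (Ibr N (s * c)).toNat ≠ 0) (j : ℕ) :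
    coeff j (Phi N ζ c d s) ∈ Subring.closure {ζ} := by
  simp only [Phi, if_neg hb, coeff_mk]
  letI : TopologicalSpace K := ⊥
  haveI : DiscreteTopology K := ⟨rfl⟩
  have hite : ∀ p : Prop, [Decidable p] → (if p then (1 : K) else 0) ∈ Subring.closure {ζ} := by
    intro p _
    split_ifs
    · exact one_mem _
    · exact zero_mem _
  have h2 : (2 : K) ∈ Subring.closure {ζ} := by
    exact_mod_cast natCast_mem (Subring.closure {ζ}) 2
  refine sub_mem (aux_tsum _ _ fun n => ?_) (aux_tsum _ _ fun m => aux_tsum _ _ fun n => ?_)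
  · split_ifs
    · exact mul_mem (natCast_mem _ _) (aux_zpow hN hζ _)
    · exact zero_mem _
  · exact mul_mem (natCast_mem _ _) (sub_mem (sub_mem (mul_mem h2 (hite _))
      (mul_mem (aux_zpow hN hζ _) (hite _))) (mul_mem (aux_zpow hN hζ _) (hite _)))

lemma aux_ibr (hN : 0 < N) (x : ℤ) : 0 ≤ Ibr N x ∧ 2 * Ibr N x ≤ N := by
  have h1 := Int.emod_nonneg x (b := N) (by omega)
  have h2 := Int.emod_lt_of_pos x (b := N) (by omega)
  unfold Ibr
  omega

lemma aux_ibr_zero (hN : 0 < N) (x : ℤ) : (Ibr N x).toNat = 0 ↔ (N : ℤ) ∣ x := by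
  have h1 := Int.emod_nonneg x (b := N) (by omega)
  have h2 := Int.emod_lt_of_pos x (b := N) (by omega)
  rw [Int.dvd_iff_emod_eq_zero]
  unfold Ibr
  omega

lemma aux_ibr_eq (hN : 0 < N) (x y : ℤ) (h : (Ibr N x).toNat = (Ibr N y).toNat) :
    (N : ℤ) ∣ x - y ∨ (N : ℤ) ∣ x + y := by
  have h1 := Int.emod_nonneg x (b := N) (by omega)
  have h2 := Int.emod_lt_of_pos x (b := N) (by omega)
  have h3 := Int.emod_nonneg y (b := N) (by omega)
  have h4 := Int.emod_lt_of_pos y (b := N) (by omega)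
  have hx := Int.emod_add_mul_ediv x N
  have hy := Int.emod_add_mul_ediv y N
  unfold Ibr at h
  have : x % N = y % N ∨ x % N + y % N = N := by omega
  rcases this with h | h
  · left; exact ⟨x / N - y / N, by linear_combination -hx + hy + h⟩
  · right; exact ⟨x / N + y / N + 1, by linear_combination -hx - hy + h⟩

lemma aux_double (j b : ℕ) (hb : 2 * b ≤ N) (hj : 2 * j < N) (m n : ℕ+) :
    j ≠ (m : ℕ) * (n : ℕ) * N ∧ j ≠ (n : ℕ) * ((m : ℕ) * N + b) ∧
      j ≠ (n : ℕ) * ((m : ℕ) * N - b) := by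
  have hm : 1 ≤ (m : ℕ) := m.pos
  have hn : 1 ≤ (n : ℕ) := n.pos
  have h1 : N ≤ (m : ℕ) * N := Nat.le_mul_of_pos_left _ hm
  refine ⟨?_, ?_, ?_⟩
  · have : 1 * 1 * N ≤ (m : ℕ) * (n : ℕ) * N := by gcongr
    omega
  · have : (m : ℕ) * N + b ≤ (n : ℕ) * ((m : ℕ) * N + b) := Nat.le_mul_of_pos_left _ hn
    omega
  · have : (m : ℕ) * N - b ≤ (n : ℕ) * ((m : ℕ) * N - b) := Nat.le_mul_of_pos_left _ hn
    omega

lemma aux_phi_low (hN : 0 < N) (c d s : ℤ)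
    (hb : (Ibr N (s * c)).toNat ≠ 0) (j : ℕ) (hj : j < (Ibr N (s * c)).toNat) :
    coeff j (Phi N ζ c d s) = 0 := by
  simp only [Phi, if_neg hb, coeff_mk]
  have h := aux_ibr hN (s * c)
  letI : TopologicalSpace K := ⊥
  have hd := aux_double (N := N) j (Ibr N (s * c)).toNat (by omega) (by omega)
  have hs : ∀ n : ℕ+, j ≠ (n : ℕ) * (Ibr N (s * c)).toNat := fun n => by
    have : (Ibr N (s * c)).toNat ≤ (n : ℕ) * (Ibr N (s * c)).toNat :=
      Nat.le_mul_of_pos_left _ n.pos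
    omega
  simp [(hd _ _).1, (hd _ _).2.1, (hd _ _).2.2, hs]

lemma aux_phi_lead (hN : 0 < N) (c d s : ℤ)
    (hb : (Ibr N (s * c)).toNat ≠ 0) (hj : 2 * (Ibr N (s * c)).toNat < N) :
    coeff (Ibr N (s * c)).toNat (Phi N ζ c d s) = ζ ^ (Imu N (s * c) * s * d) := by
  simp only [Phi, if_neg hb, coeff_mk]
  letI : TopologicalSpace K := ⊥
  have hd := aux_double (N := N) (Ibr N (s * c)).toNat (Ibr N (s * c)).toNat (by omega) hj
  have hs : ∀ n : ℕ+, n ≠ 1 → (Ibr N (s * c)).toNat ≠ (n : ℕ) * (Ibr N (s * c)).toNat := by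
    intro n hn h
    apply hn
    have : (n : ℕ) = 1 := by
      apply Nat.eq_of_mul_eq_mul_right (Nat.pos_of_ne_zero hb)
      rw [← h, one_mul]
    exact_mod_cast this
  rw [tsum_eq_single (1 : ℕ+) (fun n hn => if_neg (hs n hn))]
  simp [(hd _ _).1, (hd _ _).2.1, (hd _ _).2.2]

end roots

/-- Proposition 5: if `1 < k, ℓ ≤ N/2`, `k ≠ ℓ` and `gcd(k(ℓ±1), N) = 1`, then for every
`A = (a b; c d) ∈ SL₂(ℤ)` the q-expansion of `Λ_{k,ℓ}∘A`, namely the quotient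
`(Φ_k(A) − Φ_1(A))/(Φ_ℓ(A) − Φ_1(A))` formed in `ℚ(ζ)((q))`, has all coefficients in `ℤ[ζ]`. -/
theorem statement9 (N : ℕ) (hN : 6 < N) {K : Type*} [Field K] (ζ : K)
    (hζ : IsPrimitiveRoot ζ N) (k l : ℤ)
    (hl1 : 1 < l) (hl2 : 2 * l ≤ (N : ℤ)) (hk1 : 1 < k) (hk2 : 2 * k ≤ (N : ℤ)) (hkl : k ≠ l)
    (hg1 : Int.gcd (k * (l - 1)) N = 1) (hg2 : Int.gcd (k * (l + 1)) N = 1)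
    (a b c d : ℤ) (hA : a * d - b * c = 1) :
    Phi N ζ c d l - Phi N ζ c d 1 ≠ 0 ∧
      ∀ i : ℤ,
        (((Phi N ζ c d k - Phi N ζ c d 1 : PowerSeries K) : LaurentSeries K) /
            ((Phi N ζ c d l - Phi N ζ c d 1 : PowerSeries K) : LaurentSeries K)).coeff i ∈
          Subring.closure {ζ} := by
  have hN0 : 0 < N := by omega
  have h0 : ζ ≠ 0 := hζ.ne_zero (by omega)
  have hck1 : IsCoprime (k * (l - 1)) (N : ℤ) := Int.isCoprime_iff_gcd_eq_one.2 hg1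
  have hck2 : IsCoprime (k * (l + 1)) (N : ℤ) := Int.isCoprime_iff_gcd_eq_one.2 hg2
  have hck : IsCoprime k (N : ℤ) := hck1.of_mul_left_left
  have hcm : IsCoprime (l - 1) (N : ℤ) := hck1.of_mul_left_right
  have hcp : IsCoprime (l + 1) (N : ℤ) := hck2.of_mul_left_right
  have hcd : IsCoprime c d := ⟨-b, a, by linear_combination hA⟩
  have hlN : ¬ (N : ℤ) ∣ l := fun h => by
    have := Int.le_of_dvd (by omega) h
    omega
  have hone : ∀ n : ℤ, 1 - ζ ^ n = 0 ↔ (N : ℤ) ∣ n := fun n => by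
    rw [sub_eq_zero, eq_comm, hζ.zpow_eq_one_iff_dvd]
  have hmu : ∀ x : ℤ, (N : ℤ) ∣ x → Imu N x = 1 := fun x hx => by
    simp [Imu, Int.emod_eq_zero_of_dvd hx]
  by_cases hc : (N : ℤ) ∣ c
  · -- all constant terms present
    have hdN : IsCoprime d (N : ℤ) := by
      obtain ⟨t, rfl⟩ := hc
      exact (hcd.of_mul_left_left).symm
    have hz : ∀ s : ℤ, (Ibr N (s * c)).toNat = 0 := fun s =>
      (aux_ibr_zero hN0 _).2 (hc.mul_left s)
    have hc0 : ∀ s : ℤ, PowerSeries.coeff 0 (Phi N ζ c d s) =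
        ζ ^ (s * d) / (1 - ζ ^ (s * d)) ^ 2 := fun s => by
      rw [aux_phi_zero0 hN0 c d s (hz s), hmu _ (hc.mul_left s), one_mul]
    have hy : 1 - ζ ^ d ≠ 0 := by
      rw [Ne, hone]
      intro h
      have := (hdN.symm.isUnit_of_dvd' dvd_rfl h)
      rw [Int.isUnit_iff] at this
      omega
    have hnd : ∀ s : ℤ, IsCoprime s (N : ℤ) → 1 - ζ ^ (s * d) ≠ 0 := by
      intro s hs
      rw [Ne, hone]
      intro h
      have := ((hs.mul_left hdN).symm.isUnit_of_dvd' dvd_rfl h)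
      rw [Int.isUnit_iff] at this
      omega
    have hx : 1 - ζ ^ (l * d) ≠ 0 := by
      rw [Ne, hone]
      intro h
      exact hlN (hdN.symm.dvd_of_dvd_mul_right h)
    have hdiff : ∀ s : ℤ, 1 - ζ ^ (s * d) ≠ 0 →
        PowerSeries.coeff 0 (Phi N ζ c d s - Phi N ζ c d 1) =
        - ζ ^ d * (1 - ζ ^ ((s - 1) * d)) * (1 - ζ ^ ((s + 1) * d)) /
          ((1 - ζ ^ (s * d)) ^ 2 * (1 - ζ ^ d) ^ 2) := by
      intro s hs
      rw [map_sub, hc0, hc0, one_mul, div_sub_div _ _ (pow_ne_zero 2 hs) (pow_ne_zero 2 hy)]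
      congr 1
      have e1 : ζ ^ ((s + 1) * d) = ζ ^ (s * d) * ζ ^ d := by
        rw [← zpow_add₀ h0]; congr 1; ring
      have e2 : ζ ^ (s * d) = ζ ^ ((s - 1) * d) * ζ ^ d := by
        rw [← zpow_add₀ h0]; congr 1; ring
      rw [e1, e2]
      ring
    have hoff : ∀ s : ℤ, ∀ j : ℕ, j ≠ 0 →
        PowerSeries.coeff j (Phi N ζ c d s - Phi N ζ c d 1) ∈ Subring.closure {ζ} := by
      intro s j hj
      rw [map_sub]
      exact sub_mem (aux_phi_zero hN0 hζ c d s (hz s) j hj)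
        (aux_phi_zero hN0 hζ c d 1 (hz 1) j hj)
    have hxR : (1 - ζ ^ (l * d)) ^ 2 ∈ Subring.closure {ζ} :=
      pow_mem (sub_mem (one_mem _) (aux_zpow hN0 hζ _)) 2
    have hL : (1 - ζ ^ (l * d)) ^ 2 * PowerSeries.coeff 0 (Phi N ζ c d l - Phi N ζ c d 1) =
        - ζ ^ d * ((1 - ζ ^ ((l - 1) * d)) / (1 - ζ ^ d)) *
          ((1 - ζ ^ ((l + 1) * d)) / (1 - ζ ^ d)) := by
      rw [hdiff l hx]
      field_simp
    have hLi : ((1 - ζ ^ (l * d)) ^ 2 *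
        PowerSeries.coeff 0 (Phi N ζ c d l - Phi N ζ c d 1))⁻¹ =
        - ζ ^ (-d) * ((1 - ζ ^ d) / (1 - ζ ^ ((l - 1) * d))) *
          ((1 - ζ ^ d) / (1 - ζ ^ ((l + 1) * d))) := by
      rw [hL, mul_inv, mul_inv, inv_div, inv_div, inv_neg, zpow_neg]
    have hKk : (1 - ζ ^ (l * d)) ^ 2 * PowerSeries.coeff 0 (Phi N ζ c d k - Phi N ζ c d 1) =
        - ζ ^ d * ((1 - ζ ^ (l * d)) / (1 - ζ ^ (k * d))) ^ 2 *
          ((1 - ζ ^ ((k - 1) * d)) / (1 - ζ ^ d)) *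
          ((1 - ζ ^ ((k + 1) * d)) / (1 - ζ ^ d)) := by
      have := hnd k hck
      rw [hdiff k this]
      field_simp
    refine aux_quot (Subring.closure {ζ}) ((1 - ζ ^ (l * d)) ^ 2) (pow_ne_zero 2 hx) _ _ 0
      ?_ ?_ (by simp) ?_ ?_
    · intro j
      by_cases hj : j = 0
      · subst hj
        rw [hKk]
        exact mul_mem (mul_mem (mul_mem (neg_mem (aux_zpow hN0 hζ _))
          (pow_mem (aux_div hN0 hζ _ _ (hck.mul_left hdN)) 2)) (aux_div hN0 hζ _ _ hdN))
          (aux_div hN0 hζ _ _ hdN)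
      · exact mul_mem hxR (hoff k j hj)
    · intro j
      by_cases hj : j = 0
      · subst hj
        rw [hL]
        exact mul_mem (mul_mem (neg_mem (aux_zpow hN0 hζ _)) (aux_div hN0 hζ _ _ hdN))
          (aux_div hN0 hζ _ _ hdN)
      · exact mul_mem hxR (hoff l j hj)
    · rw [hL]
      exact mul_ne_zero (mul_ne_zero (neg_ne_zero.2 (zpow_ne_zero _ h0))
        (div_ne_zero (hnd _ hcm) hy)) (div_ne_zero (hnd _ hcp) hy)
    · rw [hLi]
      exact mul_mem (mul_mem (neg_mem (aux_zpow hN0 hζ _))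
        (aux_div hN0 hζ _ _ (hcm.mul_left hdN))) (aux_div hN0 hζ _ _ (hcp.mul_left hdN))
  · have hb1 : (Ibr N (1 * c)).toNat ≠ 0 := by
      rw [Ne, aux_ibr_zero hN0, one_mul]; exact hc
    have hbk : (Ibr N (k * c)).toNat ≠ 0 := by
      rw [Ne, aux_ibr_zero hN0]
      exact fun h => hc (hck.symm.dvd_of_dvd_mul_left h)
    have hnum : ∀ j, PowerSeries.coeff j (Phi N ζ c d k - Phi N ζ c d 1) ∈
        Subring.closure {ζ} := fun j => by
      rw [map_sub]
      exact sub_mem (aux_phi_nz hN0 hζ c d k hbk j) (aux_phi_nz hN0 hζ c d 1 hb1 j)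
    by_cases hbl : (Ibr N (l * c)).toNat = 0
    · have hlc : (N : ℤ) ∣ l * c := (aux_ibr_zero hN0 _).1 hbl
      have hx : 1 - ζ ^ (l * d) ≠ 0 := by
        rw [Ne, hone]
        intro h
        obtain ⟨u, v, huv⟩ := hcd
        apply hlN
        have := dvd_add (hlc.mul_left u) (h.mul_left v)
        rwa [show u * (l * c) + v * (l * d) = l by linear_combination l * huv] at this
      have hxR : (1 - ζ ^ (l * d)) ^ 2 ∈ Subring.closure {ζ} :=
        pow_mem (sub_mem (one_mem _) (aux_zpow hN0 hζ _)) 2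
      have hL : (1 - ζ ^ (l * d)) ^ 2 *
          PowerSeries.coeff 0 (Phi N ζ c d l - Phi N ζ c d 1) = ζ ^ (l * d) := by
        rw [map_sub, aux_phi_zero0 hN0 c d l hbl, hmu _ hlc, one_mul,
          aux_phi_low hN0 c d 1 hb1 0 (Nat.pos_of_ne_zero hb1), sub_zero]
        field_simp
      refine aux_quot (Subring.closure {ζ}) ((1 - ζ ^ (l * d)) ^ 2) (pow_ne_zero 2 hx) _ _ 0
        (fun j => mul_mem hxR (hnum j)) ?_ (by simp) ?_ ?_
      · intro j
        by_cases hj : j = 0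
        · subst hj
          rw [hL]
          exact aux_zpow hN0 hζ _
        · rw [map_sub]
          exact mul_mem hxR (sub_mem (aux_phi_zero hN0 hζ c d l hbl j hj)
            (aux_phi_nz hN0 hζ c d 1 hb1 j))
      · rw [hL]; exact zpow_ne_zero _ h0
      · rw [hL, ← zpow_neg]; exact aux_zpow hN0 hζ _
    · have hne : (Ibr N (l * c)).toNat ≠ (Ibr N (1 * c)).toNat := by
        intro h
        rcases aux_ibr_eq hN0 _ _ h with h | h
        · rw [← sub_mul] at h
          exact hc (hcm.symm.dvd_of_dvd_mul_left h)
        · rw [← add_mul] at h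
          exact hc (hcp.symm.dvd_of_dvd_mul_left h)
      have hden : ∀ j, PowerSeries.coeff j (Phi N ζ c d l - Phi N ζ c d 1) ∈
          Subring.closure {ζ} := fun j => by
        rw [map_sub]
        exact sub_mem (aux_phi_nz hN0 hζ c d l hbl j) (aux_phi_nz hN0 hζ c d 1 hb1 j)
      have i1 := aux_ibr hN0 (1 * c)
      have i2 := aux_ibr hN0 (l * c)
      rcases lt_or_gt_of_ne hne with hlt | hlt
      · have hL : (1 : K) * PowerSeries.coeff (Ibr N (l * c)).toNat
            (Phi N ζ c d l - Phi N ζ c d 1) = ζ ^ (Imu N (l * c) * l * d) := by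
          rw [map_sub, aux_phi_lead hN0 c d l hbl (by omega),
            aux_phi_low hN0 c d 1 hb1 _ hlt, sub_zero, one_mul]
        refine aux_quot (Subring.closure {ζ}) 1 one_ne_zero _ _ (Ibr N (l * c)).toNat
          (fun j => by rw [one_mul]; exact hnum j) (fun j => by rw [one_mul]; exact hden j)
          ?_ ?_ ?_
        · intro j hj
          rw [map_sub, aux_phi_low hN0 c d l hbl j hj,
            aux_phi_low hN0 c d 1 hb1 j (hj.trans hlt), sub_zero]
        · rw [hL]; exact zpow_ne_zero _ h0
        · rw [hL, ← zpow_neg]; exact aux_zpow hN0 hζ _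
      · have hL : (1 : K) * PowerSeries.coeff (Ibr N (1 * c)).toNat
            (Phi N ζ c d l - Phi N ζ c d 1) = - ζ ^ (Imu N (1 * c) * 1 * d) := by
          rw [map_sub, aux_phi_lead hN0 c d 1 hb1 (by omega),
            aux_phi_low hN0 c d l hbl _ hlt, zero_sub, one_mul]
        refine aux_quot (Subring.closure {ζ}) 1 one_ne_zero _ _ (Ibr N (1 * c)).toNat
          (fun j => by rw [one_mul]; exact hnum j) (fun j => by rw [one_mul]; exact hden j)
          ?_ ?_ ?_
        · intro j hj
          rw [map_sub, aux_phi_low hN0 c d 1 hb1 j hj,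
            aux_phi_low hN0 c d l hbl j (hj.trans hlt), sub_zero]
        · rw [hL]; exact neg_ne_zero.2 (zpow_ne_zero _ h0)
        · rw [hL, inv_neg, ← zpow_neg]; exact neg_mem (aux_zpow hN0 hζ _)
end

section
/- Let d be an integer with gcd(d, N) = 1 and let k, ℓ be integers with 1 < ℓ ≤ N/2, 1 < k ≤ N/2, k ≠ ℓ, gcd(k(ℓ−1), N) = 1 and gcd(k(ℓ+1), N) = 1. Then (1−ζ^{kd})²·(1−ζ^{(ℓ−1)d})·(1−ζ^{(ℓ+1)d}) divides (1−ζ^{ℓd})²·(1−ζ^{(k−1)d})·(1−ζ^{(k+1)d}) in the ring ℤ[ζ]; in other words, the quotient ((1−ζ^{ℓd})/(1−ζ^{kd}))² · (1−ζ^{(k−1)d})(1−ζ^{(k+1)d}) / ((1−ζ^{(ℓ−1)d})(1−ζ^{(ℓ+1)d})) lies in ℤ[ζ]. -/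
lemma aux_div_s10 (N : ℕ) (hN : 6 < N) {K : Type*} [Field K] (ζ : K)
    (hζ : IsPrimitiveRoot ζ N) (m n : ℤ) (hm : Int.gcd m N = 1) :
    ∃ b ∈ Subring.closure {ζ}, 1 - ζ ^ n = (1 - ζ ^ m) * b := by
  have : NeZero N := ⟨by omega⟩
  have hroot : ∀ j : ℤ, (ζ ^ j) ^ N = 1 := fun j => by
    rw [← zpow_natCast, ← zpow_mul, mul_comm, zpow_mul, zpow_natCast, hζ.pow_eq_one, one_zpow]
  have hp : IsPrimitiveRoot (ζ ^ m) N := hζ.zpow_of_gcd_eq_one m hm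
  obtain ⟨i, -, hi⟩ := hp.eq_pow_of_pow_eq_one (hroot n)
  obtain ⟨j, -, hj⟩ := hζ.eq_pow_of_pow_eq_one (hroot m)
  have hmem : ζ ^ m ∈ Subring.closure {ζ} := by
    rw [← hj]
    exact pow_mem (Subring.subset_closure (Set.mem_singleton ζ)) j
  refine ⟨∑ t ∈ Finset.range i, (ζ ^ m) ^ t, sum_mem fun t _ => pow_mem hmem t, ?_⟩
  rw [mul_neg_geom_sum, hi]

/-- The key divisibility in the proof of Proposition 5 (case `c ≡ 0 mod N`): for `gcd(d,N)=1`
and `1 < k, ℓ ≤ N/2`, `k ≠ ℓ`, `gcd(k(ℓ±1), N) = 1`, the element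
`(1−ζ^{kd})²(1−ζ^{(ℓ−1)d})(1−ζ^{(ℓ+1)d})` divides
`(1−ζ^{ℓd})²(1−ζ^{(k−1)d})(1−ζ^{(k+1)d})` in `ℤ[ζ]`. -/
theorem statement10 (N : ℕ) (hN : 6 < N) {K : Type*} [Field K] (ζ : K)
    (hζ : IsPrimitiveRoot ζ N) (d : ℤ) (hd : Int.gcd d N = 1) (k l : ℤ)
    (hl1 : 1 < l) (hl2 : 2 * l ≤ (N : ℤ)) (hk1 : 1 < k) (hk2 : 2 * k ≤ (N : ℤ)) (hkl : k ≠ l)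
    (hg1 : Int.gcd (k * (l - 1)) N = 1) (hg2 : Int.gcd (k * (l + 1)) N = 1) :
    ∃ β ∈ Subring.closure {ζ},
      (1 - ζ ^ (l * d)) ^ 2 * (1 - ζ ^ ((k - 1) * d)) * (1 - ζ ^ ((k + 1) * d)) =
        (1 - ζ ^ (k * d)) ^ 2 * (1 - ζ ^ ((l - 1) * d)) * (1 - ζ ^ ((l + 1) * d)) * β := by
  have key : ∀ a : ℤ, IsCoprime a (N : ℤ) → Int.gcd (a * d) N = 1 := fun a ha =>
    Int.isCoprime_iff_gcd_eq_one.mp (ha.mul_left (Int.isCoprime_iff_gcd_eq_one.mpr hd))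
  have h1 := Int.isCoprime_iff_gcd_eq_one.mpr hg1
  have h2 := Int.isCoprime_iff_gcd_eq_one.mpr hg2
  obtain ⟨a, ha, ea⟩ := aux_div_s10 N hN ζ hζ (k * d) (l * d) (key _ h1.of_mul_left_left)
  obtain ⟨b, hb, eb⟩ := aux_div_s10 N hN ζ hζ ((l - 1) * d) ((k - 1) * d) (key _ h1.of_mul_left_right)
  obtain ⟨c, hc, ec⟩ := aux_div_s10 N hN ζ hζ ((l + 1) * d) ((k + 1) * d) (key _ h2.of_mul_left_right)
  refine ⟨a ^ 2 * b * c, mul_mem (mul_mem (pow_mem ha 2) hb) hc, ?_⟩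
  rw [ea, eb, ec]
  ring
end

section
/- Let d be an integer with gcd(d, N) = 1, let k be an integer with 2 < k < N/2, and put δ = gcd(k, N). Assume either (i) δ = 1, or (ii) δ > 1, gcd(δ, 3) = 1 and N/δ is not a power of a prime number (i.e., N/δ is divisible by at least two distinct primes). Then (1−ζ^{kd})²·(1−ζ^{d})·(1−ζ^{3d}) divides (1−ζ^{2d})²·(1−ζ^{(k−1)d})·(1−ζ^{(k+1)d}) in the ring ℤ[ζ]; in other words, the quotient ((1−ζ^{2d})/(1−ζ^{kd}))² · (1−ζ^{(k−1)d})(1−ζ^{(k+1)d}) / ((1−ζ^{d})(1−ζ^{3d})) lies in ℤ[ζ]. -/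
theorem aux_dvd {R : Type*} [CommRing R] (x : R) {a b : ℕ} (h : a ∣ b) :
    1 - x ^ a ∣ 1 - x ^ b := by
  obtain ⟨c, rfl⟩ := h
  have := sub_dvd_pow_sub_pow 1 (x ^ a) c
  rwa [one_pow, ← pow_mul] at this

theorem aux_coprime {R : Type*} [CommRing R] {x : R} {N m : ℕ} (hN : 1 < N)
    (hx : x ^ N = 1) (h : Nat.Coprime m N) : 1 - x ^ m ∣ 1 - x := by
  obtain ⟨j, hj⟩ := Nat.exists_mul_mod_eq_one_of_coprime h hN
  have h1 : x ^ (m * j) = x := by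
    rw [pow_eq_pow_mod _ hx, hj.2, pow_one]
  have := aux_dvd x (Dvd.intro j rfl : m ∣ m * j)
  rwa [h1] at this

theorem aux_prime {R : Type*} [CommRing R] [IsDomain R] {u : R} {n p : ℕ} (hn : 0 < n)
    (hu : IsPrimitiveRoot u n) (hp : p.Prime) (h : p ∣ n) : 1 - u ∣ (p : R) := by
  obtain ⟨c, rfl⟩ := h
  have hη : IsPrimitiveRoot (u ^ c) p := hu.pow hn (mul_comm p c)
  have hs := hη.geom_sum_eq_zero hp.one_lt
  have h2 : (p : R) = ∑ i ∈ Finset.range p, (1 - (u ^ c) ^ i) := by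
    rw [Finset.sum_sub_distrib, hs]; simp
  rw [h2]
  refine Finset.dvd_sum fun i _ => ?_
  have := aux_dvd u (one_dvd (c * i))
  rwa [pow_one, pow_mul] at this

theorem aux_unit {R : Type*} [CommRing R] [IsDomain R] {u : R} {n p q : ℕ} (hn : 0 < n)
    (hu : IsPrimitiveRoot u n) (hp : p.Prime) (hq : q.Prime) (hpq : p ≠ q)
    (h : p ∣ n) (h' : q ∣ n) : 1 - u ∣ 1 := by
  have h1 := aux_prime hn hu hp h
  have h2 := aux_prime hn hu hq h'
  have hc : IsCoprime (p : R) (q : R) :=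
    ((Nat.coprime_primes hp hq).2 hpq).cast
  obtain ⟨a, b, hab⟩ := hc
  have h3 := dvd_add (h1.mul_left a) (h2.mul_left b)
  rwa [hab] at h3

theorem aux_main {R : Type*} [CommRing R] [IsDomain R] {w : R} {N k : ℕ} (hN : 6 < N)
    (hw : IsPrimitiveRoot w N) (hk1 : 2 < k)
    (hδ : Nat.gcd k N = 1 ∨
      (1 < Nat.gcd k N ∧ Nat.gcd (Nat.gcd k N) 3 = 1 ∧
        ∃ p q : ℕ, p.Prime ∧ q.Prime ∧ p ≠ q ∧
          p ∣ N / Nat.gcd k N ∧ q ∣ N / Nat.gcd k N)) :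
    (1 - w ^ k) ^ 2 * (1 - w) * (1 - w ^ 3) ∣
      (1 - w ^ 2) ^ 2 * (1 - w ^ (k - 1)) * (1 - w ^ (k + 1)) := by
  have one (m : ℕ) : 1 - w ∣ 1 - w ^ m := by simpa using aux_dvd w (one_dvd m)
  have hk : 1 - w ^ k ∣ 1 - w ^ 2 := by
    rcases hδ with h | ⟨_, _, p, q, hp, hq, hpq, h1, h2⟩
    · exact (aux_coprime (by omega) hw.pow_eq_one h).trans (one 2)
    · have hg : 0 < Nat.gcd k N := Nat.gcd_pos_of_pos_left _ (by omega)
      have hn : 0 < N / Nat.gcd k N :=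
        Nat.div_pos (Nat.le_of_dvd (by omega) (Nat.gcd_dvd_right k N)) hg
      have hu : IsPrimitiveRoot (w ^ k) (N / Nat.gcd k N) := by
        have h3 : orderOf (w ^ k) = N / Nat.gcd k N := by
          rw [orderOf_pow' w (by omega), ← hw.eq_orderOf, Nat.gcd_comm]
        rw [← h3]
        exact IsPrimitiveRoot.orderOf _
      exact (aux_unit hn hu hp hq hpq h1 h2).trans (one_dvd _)
  have h3 : (1 - w) * (1 - w ^ 3) ∣ (1 - w ^ (k - 1)) * (1 - w ^ (k + 1)) := by
    have hc : 3 ∣ k - 1 ∨ 3 ∣ k + 1 ∨ 3 ∣ k := by omega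
    rcases hc with h | h | h
    · rw [mul_comm]; exact mul_dvd_mul (aux_dvd w h) (one _)
    · exact mul_dvd_mul (one _) (aux_dvd w h)
    · have h3N : Nat.Coprime 3 N := by
        rw [Nat.Prime.coprime_iff_not_dvd Nat.prime_three]
        intro h'
        have hd := Nat.dvd_gcd h h'
        rcases hδ with h1 | ⟨_, h1, _⟩
        · rw [h1] at hd; omega
        · rw [Nat.gcd_eq_right hd] at h1; omega
      exact mul_dvd_mul (one _) ((aux_coprime (by omega) hw.pow_eq_one h3N).trans (one _))
  rw [mul_assoc, mul_assoc]
  exact mul_dvd_mul (pow_dvd_pow_of_dvd hk 2) h3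

/-- The key divisibility in the proof of Proposition 6 (case `c ≡ 0 mod N`): for `gcd(d,N)=1`,
`2 < k < N/2` and `δ = gcd(k,N)` with (i) `δ = 1`, or (ii) `δ > 1`, `gcd(δ,3) = 1` and `N/δ`
not a prime power, the element `(1−ζ^{kd})²(1−ζ^{d})(1−ζ^{3d})` divides
`(1−ζ^{2d})²(1−ζ^{(k−1)d})(1−ζ^{(k+1)d})` in `ℤ[ζ]`. -/
theorem statement13 (N : ℕ) (hN : 6 < N) {K : Type*} [Field K] (ζ : K)
    (hζ : IsPrimitiveRoot ζ N) (d : ℤ) (hd : Int.gcd d N = 1)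
    (k : ℤ) (hk1 : 2 < k) (hk2 : 2 * k < (N : ℤ))
    (hδ : Int.gcd k N = 1 ∨
      (1 < Int.gcd k N ∧ Nat.gcd (Int.gcd k N) 3 = 1 ∧
        ∃ p q : ℕ, p.Prime ∧ q.Prime ∧ p ≠ q ∧
          p ∣ N / Int.gcd k N ∧ q ∣ N / Int.gcd k N)) :
    ∃ β ∈ Subring.closure {ζ},
      (1 - ζ ^ (2 * d)) ^ 2 * (1 - ζ ^ ((k - 1) * d)) * (1 - ζ ^ ((k + 1) * d)) =
        (1 - ζ ^ (k * d)) ^ 2 * (1 - ζ ^ d) * (1 - ζ ^ (3 * d)) * β := by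
  obtain ⟨k, rfl⟩ := Int.eq_ofNat_of_zero_le (by omega : 0 ≤ k)
  simp only [Int.gcd_natCast_natCast] at hδ
  have hNZ : (N : ℤ) ≠ 0 := by omega
  obtain ⟨e, he⟩ := Int.eq_ofNat_of_zero_le (Int.emod_nonneg d hNZ)
  have hζ0 : ζ ≠ 0 := hζ.ne_zero (by omega)
  have hde : ζ ^ d = ζ ^ e := by
    have h1 : ζ ^ (N : ℤ) = 1 := by rw [zpow_natCast]; exact hζ.pow_eq_one
    conv_lhs => rw [← Int.emod_add_mul_ediv d N]
    rw [zpow_add₀ hζ0, zpow_mul, h1, one_zpow, mul_one, he, zpow_natCast]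
  have hp : IsPrimitiveRoot (ζ ^ d) N := hζ.zpow_of_gcd_eq_one d hd
  let z : Subring.closure {ζ} := ⟨ζ, Subring.subset_closure rfl⟩
  have hz : ((z ^ e : Subring.closure {ζ}) : K) = ζ ^ d := by rw [hde]; rfl
  have hw : IsPrimitiveRoot (z ^ e) N := by
    refine IsPrimitiveRoot.of_map_of_injective (f := (Subring.closure {ζ}).subtype) ?_
      Subtype.val_injective
    change IsPrimitiveRoot ((z ^ e : Subring.closure {ζ}) : K) N
    rw [hz]; exact hp
  obtain ⟨β, hβ⟩ := aux_main hN hw (by omega) hδ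
  refine ⟨β, β.2, ?_⟩
  have hβ' := congrArg (Subtype.val) hβ
  simp only [Subring.coe_mul, Subring.coe_pow, AddSubgroupClass.coe_sub, Subring.coe_one] at hβ'
  have hz' : (z : K) ^ e = ζ ^ d := hde.symm
  rw [hz'] at hβ'
  have hm (m : ℕ) : (ζ ^ d) ^ m = ζ ^ ((m : ℤ) * d) := by
    rw [mul_comm, zpow_mul, zpow_natCast]
  simp only [hm] at hβ'
  rw [Nat.cast_sub (by omega)] at hβ'
  push_cast at hβ'
  exact hβ'
end

section
/- Let k, ℓ be integers with 1 < ℓ < N/2, 1 < k < N/2 and k ≠ ℓ. Then (1−ζ^{ℓ})²·(1−ζ^{k−1})·(1−ζ^{k+1}) ≠ (1−ζ^{k})²·(1−ζ^{ℓ−1})·(1−ζ^{ℓ+1}); equivalently, the quantities θ_k = −ζ(1−ζ^{k−1})(1−ζ^{k+1})/((1−ζ^{k})²(1−ζ)²) and θ_ℓ = −ζ(1−ζ^{ℓ−1})(1−ζ^{ℓ+1})/((1−ζ^{ℓ})²(1−ζ)²) are distinct. -/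
/-- The fact `θ_k ≠ θ_ℓ` from the proof of Theorem 1: for `1 < k, ℓ < N/2` with `k ≠ ℓ`,
`(1−ζ^ℓ)²(1−ζ^{k−1})(1−ζ^{k+1}) ≠ (1−ζ^k)²(1−ζ^{ℓ−1})(1−ζ^{ℓ+1})`; equivalently
`−ζ(1−ζ^{k−1})(1−ζ^{k+1})/((1−ζ^k)²(1−ζ)²) ≠ −ζ(1−ζ^{ℓ−1})(1−ζ^{ℓ+1})/((1−ζ^ℓ)²(1−ζ)²)`. -/
theorem statement16 (N : ℕ) (hN : 6 < N) {K : Type*} [Field K] (ζ : K)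
    (hζ : IsPrimitiveRoot ζ N) (k l : ℤ)
    (hl1 : 1 < l) (hl2 : 2 * l < (N : ℤ)) (hk1 : 1 < k) (hk2 : 2 * k < (N : ℤ)) (hkl : k ≠ l) :
    (1 - ζ ^ l) ^ 2 * (1 - ζ ^ (k - 1)) * (1 - ζ ^ (k + 1)) ≠
      (1 - ζ ^ k) ^ 2 * (1 - ζ ^ (l - 1)) * (1 - ζ ^ (l + 1)) := by
  intro h
  have h0 : ζ ≠ 0 := hζ.ne_zero (by omega)
  have h1 : ζ ≠ 1 := hζ.ne_one (by omega)
  have hz : ∀ m : ℤ, m ≠ 0 → |m| < (N : ℤ) → ζ ^ m ≠ 1 := by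
    intro m hm hlt he
    exact hm (Int.eq_zero_of_abs_lt_dvd ((hζ.zpow_eq_one_iff_dvd m).1 he) hlt)
  have ha : ζ ^ (k + l) ≠ 1 := hz _ (by omega) (by rw [abs_lt]; omega)
  have hb : ζ ^ (k - l) ≠ 1 := hz _ (by omega) (by rw [abs_lt]; omega)
  rw [zpow_add₀ h0] at ha
  rw [zpow_sub₀ h0, Ne, div_eq_one_iff_eq (zpow_ne_zero _ h0)] at hb
  rw [zpow_sub_one₀ h0, zpow_sub_one₀ h0, zpow_add_one₀ h0, zpow_add_one₀ h0] at h
  generalize ζ ^ k = a at *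
  generalize ζ ^ l = b at *
  have key : (1 - ζ) ^ 2 * ((a - b) * (1 - a * b)) = 0 := by
    have h2 : ζ * ζ⁻¹ = 1 := mul_inv_cancel₀ h0
    field_simp at h
    linear_combination -h
  have e1 : (1 - ζ) ^ 2 ≠ 0 := pow_ne_zero _ (sub_ne_zero.2 (Ne.symm h1))
  exact mul_ne_zero e1 (mul_ne_zero (sub_ne_zero.2 hb) (sub_ne_zero.2 (Ne.symm ha))) key
end
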